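/- Let d ≥ 2 and let μ₀ be a Borel probability measure on ℝ^d. There exists a constant c > 0 (depending on μ₀ and d) such that for every t ∈ (1/12, 1] and every x ∈ ℝ^d, ∫_{ℝ^d} p(t, x−y) μ₀(dy) ≥ c · ∫_Q p(t − 1/12, x−z) dz. -/

import Mathlib

open MeasureTheory Real Set
open scoped ENNReal

noncomputable section

/-- `ℝ^d` with the Euclidean structure. -/
abbrev Rd (d : ℕ) := EuclideanSpace ℝ (Fin d)

/-- The closed unit cube `Q = [-1/2, 1/2]^d`. -/
def unitCube (d : ℕ) : Set (Rd d) := {x | ∀ i, |x i| ≤ 1 / 2}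

/-- The heat kernel `p(t,x) = (4πt)^{-d/2} exp(-|x|²/(4t))` on `ℝ^d`. -/
noncomputable def heatKernel (d : ℕ) (t : ℝ) (x : Rd d) : ℝ :=
  (4 * π * t) ^ (-(d : ℝ) / 2) * Real.exp (-‖x‖ ^ 2 / (4 * t))

/-- `∫_Q p(t, x - z) dz`. -/
noncomputable def cubeHeat (d : ℕ) (t : ℝ) (x : Rd d) : ℝ :=
  ∫ z in unitCube d, heatKernel d t (x - z)

/-- Heat evolution `(e^{tΔ}μ)(x) = ∫ p(t, x-y) μ(dy)` of a measure `μ`. -/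
noncomputable def heatEvol (d : ℕ) (μ : Measure (Rd d)) (t : ℝ) (x : Rd d) : ℝ :=
  ∫ y, heatKernel d t (x - y) ∂μ

theorem exists_measure_closedBall_pos {E : Type*} [SeminormedAddCommGroup E] [MeasurableSpace E]
    (μ : Measure E) [NeZero μ] : ∃ R : ℝ, 0 < μ (Metric.closedBall 0 R) := by
  by_contra! h
  refine NeZero.ne μ (Measure.measure_univ_eq_zero.mp ?_)
  rw [← Metric.iUnion_closedBall_nat (0 : E)]
  exact measure_iUnion_null fun n => nonpos_iff_eq_zero.mp (h n)

theorem norm_le_of_mem_unitCube {d : ℕ} {z : Rd d} (hz : z ∈ unitCube d) : ‖z‖ ≤ √d := by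
  rw [EuclideanSpace.norm_eq]
  apply Real.sqrt_le_sqrt
  calc ∑ i, ‖z i‖ ^ 2 ≤ ∑ _i : Fin d, (1 : ℝ) := by
        gcongr with i
        have := hz i
        rw [Real.norm_eq_abs]
        exact pow_le_one₀ (abs_nonneg _) (by linarith)
    _ = d := by simp

theorem measurableSet_unitCube (d : ℕ) : MeasurableSet (unitCube d) := by
  have : unitCube d = ⋂ i, {x : Rd d | |x i| ≤ 1 / 2} := by
    ext x
    simp [unitCube]
  rw [this]
  exact (isClosed_iInter fun i =>
    isClosed_le (by fun_prop) continuous_const).measurableSet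

theorem add_sq_div_le {a b t u : ℝ} (hu : 0 < u) (hut : u < t) :
    (a + b) ^ 2 / t ≤ a ^ 2 / u + b ^ 2 / (t - u) := by
  have h : 0 < t - u := sub_pos.mpr hut
  have ht : 0 < t := hu.trans hut
  rw [div_add_div _ _ hu.ne' h.ne', div_le_div_iff₀ ht (mul_pos hu h)]
  nlinarith [sq_nonneg (a * (t - u) - b * u)]

theorem heatKernel_nonneg (d : ℕ) {t : ℝ} (ht : 0 ≤ t) (x : Rd d) : 0 ≤ heatKernel d t x := by
  unfold heatKernel
  positivity

theorem integrable_heatKernel_sub (d : ℕ) (μ : Measure (Rd d)) [IsFiniteMeasure μ] {t : ℝ}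
    (ht : 0 ≤ t) (x : Rd d) : Integrable (fun y => heatKernel d t (x - y)) μ := by
  refine Integrable.of_bound (C := (4 * π * t) ^ (-(d : ℝ) / 2)) ?_ (ae_of_all _ fun y => ?_)
  · unfold heatKernel
    fun_prop
  · rw [Real.norm_of_nonneg (heatKernel_nonneg d ht _)]
    refine mul_le_of_le_one_right (by positivity) (Real.exp_le_one_iff.mpr ?_)
    rw [neg_div]
    exact neg_nonpos.mpr (by positivity)

/-- A point at distance at most `b` from `y` sees, up to a constant, a slightly narrower Gaussian
at an earlier time. -/
theorem exp_mul_exp_le_heatKernel {d : ℕ} {t b : ℝ} (ht : t ∈ Ioc (1/12 : ℝ) 1)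
    {x y z : Rd d} (hyz : ‖z - y‖ ≤ b) :
    (4 * π) ^ (-(d : ℝ) / 2) * rexp (-6 * b ^ 2) *
      rexp (-(23 / (96 * (t - 1/12))) * ‖x - z‖ ^ 2) ≤ heatKernel d t (x - y) := by
  obtain ⟨h1, h2⟩ := ht
  have hs : 0 < t - 1/12 := by linarith
  have ht0 : 0 < t := by linarith
  have hb : 0 ≤ b := (norm_nonneg _).trans hyz
  have htri : ‖x - y‖ ≤ ‖x - z‖ + b := by
    have := norm_add_le (x - z) (z - y)
    rw [sub_add_sub_cancel] at this
    linarith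
  have key : ‖x - y‖ ^ 2 / t ≤ ‖x - z‖ ^ 2 / (24 * (t - 1/12) / 23) + 24 * b ^ 2 := by
    have hut : 1 / 24 ≤ t - 24 * (t - 1/12) / 23 := by linarith
    calc ‖x - y‖ ^ 2 / t ≤ (‖x - z‖ + b) ^ 2 / t := by gcongr
      _ ≤ ‖x - z‖ ^ 2 / (24 * (t - 1/12) / 23) + b ^ 2 / (t - 24 * (t - 1/12) / 23) :=
        add_sq_div_le (by positivity) (by linarith)
      _ ≤ ‖x - z‖ ^ 2 / (24 * (t - 1/12) / 23) + b ^ 2 / (1 / 24) := by gcongr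
      _ = _ := by ring
  rw [mul_assoc, ← Real.exp_add, heatKernel]
  refine mul_le_mul ?_ (Real.exp_le_exp.mpr ?_) (by positivity) (by positivity)
  · refine Real.rpow_le_rpow_of_nonpos (by positivity) ?_ ?_
    · exact mul_le_of_le_one_right (by positivity) h2
    · rw [neg_div]
      exact neg_nonpos.mpr (by positivity)
  · have e1 : -‖x - y‖ ^ 2 / (4 * t) = -(‖x - y‖ ^ 2 / t) / 4 := by
      field_simp
    have e2 : ‖x - z‖ ^ 2 / (24 * (t - 1/12) / 23) =
        4 * (23 / (96 * (t - 1/12)) * ‖x - z‖ ^ 2) := by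
      generalize t - 1/12 = s at hs
      field_simp
      ring
    rw [e1]
    linarith

theorem integral_exp_neg_mul_norm_sub_sq (d : ℕ) {b : ℝ} (hb : 0 < b) (x : Rd d) :
    ∫ z, rexp (-b * ‖x - z‖ ^ 2) = (π / b) ^ ((d : ℝ) / 2) := by
  rw [integral_sub_left_eq_self (fun z : Rd d => rexp (-b * ‖z‖ ^ 2)) volume x,
    GaussianFourier.integral_rexp_neg_mul_sq_norm hb, finrank_euclideanSpace_fin]

/-- If a multiple of a narrower Gaussian is bounded by `G` on the cube, then so is a multiple of
the heat evolution of the cube. -/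
theorem mul_cubeHeat_le {d : ℕ} {s L G : ℝ} (hs : 0 < s) (hL : 0 ≤ L) {x : Rd d}
    (h : ∀ z ∈ unitCube d, L * rexp (-(23 / (96 * s)) * ‖x - z‖ ^ 2) ≤ G) (hG : 0 ≤ G) :
    L * cubeHeat d s x ≤ 24 ^ ((d : ℝ) / 2) * G := by
  have hb : 0 < 1 / (96 * s) := by positivity
  have hint := integral_exp_neg_mul_norm_sub_sq d hb x
  have hI : Integrable (fun z : Rd d => rexp (-(1 / (96 * s)) * ‖x - z‖ ^ 2)) := by
    refine Integrable.of_integral_ne_zero ?_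
    rw [hint]
    positivity
  set A : ℝ := (4 * π * s) ^ (-(d : ℝ) / 2)
  have hA : 0 ≤ A := by positivity
  have hAinv : A * (4 * π * s) ^ ((d : ℝ) / 2) = 1 := by
    rw [← Real.rpow_add (by positivity), neg_div, neg_add_cancel, Real.rpow_zero]
  calc L * cubeHeat d s x = ∫ z in unitCube d, L * heatKernel d s (x - z) :=
        (integral_const_mul _ _).symm
    _ ≤ ∫ z in unitCube d, G * A * rexp (-(1 / (96 * s)) * ‖x - z‖ ^ 2) := by
        refine integral_mono_of_nonneg
          (ae_of_all _ fun z => mul_nonneg hL (heatKernel_nonneg d hs.le _))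
          (hI.integrableOn.const_mul _) ?_
        refine (ae_restrict_iff' (measurableSet_unitCube d)).mpr (ae_of_all _ fun z hz => ?_)
        have e : rexp (-‖x - z‖ ^ 2 / (4 * s)) = rexp (-(23 / (96 * s)) * ‖x - z‖ ^ 2) *
            rexp (-(1 / (96 * s)) * ‖x - z‖ ^ 2) := by
          rw [← Real.exp_add]
          congr 1
          field_simp
          ring
        calc L * heatKernel d s (x - z) = L * rexp (-(23 / (96 * s)) * ‖x - z‖ ^ 2) *
              (A * rexp (-(1 / (96 * s)) * ‖x - z‖ ^ 2)) := by
              rw [heatKernel, e]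
              ring
          _ ≤ G * (A * rexp (-(1 / (96 * s)) * ‖x - z‖ ^ 2)) := by
              gcongr
              exact h z hz
          _ = _ := by ring
    _ ≤ ∫ z, G * A * rexp (-(1 / (96 * s)) * ‖x - z‖ ^ 2) :=
        setIntegral_le_integral (hI.const_mul _) (ae_of_all _ fun z => by positivity)
    _ = G * (A * (π / (1 / (96 * s))) ^ ((d : ℝ) / 2)) := by
        rw [integral_const_mul, hint, mul_assoc]
    _ = 24 ^ ((d : ℝ) / 2) * G := by
        have e : π / (1 / (96 * s)) = 24 * (4 * π * s) := by
          field_simp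
          norm_num
        rw [e, Real.mul_rpow (by norm_num) (by positivity), mul_left_comm A, hAinv]
        ring

/-- For `d ≥ 2` and a Borel probability measure `μ₀` on `ℝ^d`, there is
`c > 0` such that for every `t ∈ (1/12, 1]` and every `x`,
`∫ p(t, x-y) μ₀(dy) ≥ c ∫_Q p(t - 1/12, x-z) dz`. -/
theorem stmt_9 (d : ℕ) (hd : 2 ≤ d) (μ₀ : Measure (Rd d)) [IsProbabilityMeasure μ₀] :
    ∃ c : ℝ, 0 < c ∧ ∀ t ∈ Ioc (1/12 : ℝ) 1, ∀ x : Rd d,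
      c * cubeHeat d (t - 1/12) x ≤ heatEvol d μ₀ t x := by
  obtain ⟨R, hR⟩ := exists_measure_closedBall_pos μ₀
  set κ : ℝ := μ₀.real (Metric.closedBall 0 R)
  have hκ : 0 < κ := ENNReal.toReal_pos hR.ne' (measure_ne_top _ _)
  set M : ℝ := (4 * π) ^ (-(d : ℝ) / 2) * rexp (-6 * (√d + R) ^ 2)
  have hM : 0 < M := by positivity
  refine ⟨κ * M / 24 ^ ((d : ℝ) / 2), by positivity, fun t ht x => ?_⟩
  have ht0 : 0 ≤ t := by linarith [ht.1]
  have hG : 0 ≤ heatEvol d μ₀ t x := integral_nonneg fun y => heatKernel_nonneg d ht0 _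
  rw [div_mul_eq_mul_div, div_le_iff₀' (by positivity)]
  refine mul_cubeHeat_le (by linarith [ht.1]) (by positivity) (fun z hz => ?_) hG
  have hint := integrable_heatKernel_sub d μ₀ ht0 x
  calc κ * M * rexp (-(23 / (96 * (t - 1/12))) * ‖x - z‖ ^ 2)
      = ∫ _y in Metric.closedBall (0 : Rd d) R,
          M * rexp (-(23 / (96 * (t - 1/12))) * ‖x - z‖ ^ 2) ∂μ₀ := by
        rw [setIntegral_const, smul_eq_mul, mul_assoc]
    _ ≤ ∫ y in Metric.closedBall (0 : Rd d) R, heatKernel d t (x - y) ∂μ₀ := by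
        refine setIntegral_mono_on (integrable_const _) hint.integrableOn
          Metric.isClosed_closedBall.measurableSet fun y hy => ?_
        refine exp_mul_exp_le_heatKernel ht ((norm_sub_le z y).trans ?_)
        exact add_le_add (norm_le_of_mem_unitCube hz) (mem_closedBall_zero_iff.mp hy)
    _ ≤ heatEvol d μ₀ t x :=
        setIntegral_le_integral hint (ae_of_all _ fun y => heatKernel_nonneg d ht0 _)

end
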